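/- Let Λ be an artin algebra, M an indecomposable finite length Λ-module, and Y a module with a homogeneous M-filtration. If U is a piling submodule of Y with |U| ≥ |M|, then every Gabriel-Roiter filtration of U contains a module isomorphic to M. -/

import Mathlib

/-!
Setting: `k` is a commutative artinian ring and `Λ` an artin `k`-algebra
(an algebra over `k` which is finitely generated as a `k`-module).
All modules considered are `Λ`-modules of finite length (`IsFiniteLength Λ M`),
and `|M|` denotes the length of `M`, implemented as the height
`Order.height (⊤ : Submodule Λ M)` of the lattice of submodules
(for a submodule `N` of an ambient module, its length is `Order.height N`).
-/

universe u v

open Submodule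

section GRDefs

variable (Λ : Type u) [Ring Λ]

/-- A submodule `N` of an ambient module is indecomposable (as a module):
it is nonzero, and whenever it is the direct sum of two submodules, one of them is zero. -/
def IndecSub {Y : Type v} [AddCommGroup Y] [Module Λ Y] (N : Submodule Λ Y) : Prop :=
  N ≠ ⊥ ∧ ∀ A B : Submodule Λ Y, A ≤ N → B ≤ N → A ⊔ B = N → A ⊓ B = ⊥ → A = ⊥ ∨ B = ⊥

/-- A module is indecomposable iff its top submodule is. -/
def IndecMod (M : Type v) [AddCommGroup M] [Module Λ M] : Prop :=
  IndecSub Λ (⊤ : Submodule Λ M)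

/-- The length `|M|` of a module, as an extended natural number. -/
noncomputable def modLen (M : Type v) [AddCommGroup M] [Module Λ M] : ℕ∞ :=
  Order.height (⊤ : Submodule Λ M)

/-- The length `|N|` of a submodule of an ambient module, as a natural number. -/
noncomputable def subLen {Y : Type v} [AddCommGroup Y] [Module Λ Y] (N : Submodule Λ Y) : ℕ :=
  (Order.height N).toNat

open Classical in
/-- Fuel-based auxiliary function for the Gabriel-Roiter measure. -/
noncomputable def muAux {Y : Type v} [AddCommGroup Y] [Module Λ Y] :
    ℕ → Submodule Λ Y → ℝ
  | 0, _ => 0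
  | n + 1, N =>
      (if IndecSub Λ N then (2 : ℝ) ^ (-(subLen Λ N : ℤ)) else 0)
        + sSup (muAux n '' {N' : Submodule Λ Y | N' < N})

/-- The Gabriel-Roiter measure `μ(N)` of a submodule `N` of an ambient module:
`μ(0) = 0`; if `N ≠ 0` is decomposable, `μ(N)` is the maximum of `μ(N')` over proper
submodules `N'` of `N`; if `N` is indecomposable, `μ(N) = 2^(-|N|)` plus this maximum.
(For modules of finite length the supremum is a maximum and the fuel `|N|` suffices for
the recursion, so this agrees with the usual inductive definition; the measure of a
submodule depends only on the sublattice of its submodules, hence it does not matter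
in which ambient module it is computed.) -/
noncomputable def mu {Y : Type v} [AddCommGroup Y] [Module Λ Y] (N : Submodule Λ Y) : ℝ :=
  muAux Λ (subLen Λ N) N

/-- The Gabriel-Roiter measure of a module. -/
noncomputable def muMod (M : Type v) [AddCommGroup M] [Module Λ M] : ℝ :=
  mu Λ (⊤ : Submodule Λ M)

/-- `X` is a Gabriel-Roiter submodule of the (indecomposable, non-simple) ambient
module `Y`: `X` is an indecomposable proper submodule with `μ(Y) = μ(X) + 2^(-|Y|)`. -/
def IsGRSub {Y : Type v} [AddCommGroup Y] [Module Λ Y] (X : Submodule Λ Y) : Prop :=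
  IndecMod Λ Y ∧ IndecSub Λ X ∧ X ≠ ⊤ ∧
    mu Λ (⊤ : Submodule Λ Y) = mu Λ X + (2 : ℝ) ^ (-(subLen Λ (⊤ : Submodule Λ Y) : ℤ))

/-- A map `u : X → Y` is a Gabriel-Roiter inclusion iff it is injective and its
image is a Gabriel-Roiter submodule of `Y`. -/
def IsGRInclusion {X Y : Type v} [AddCommGroup X] [Module Λ X] [AddCommGroup Y] [Module Λ Y]
    (u : X →ₗ[Λ] Y) : Prop :=
  Function.Injective u ∧ IsGRSub Λ (LinearMap.range u)

/-- A linear map is a split monomorphism. -/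
def IsSplitMonoHom {A B : Type v} [AddCommGroup A] [Module Λ A] [AddCommGroup B] [Module Λ B]
    (f : A →ₗ[Λ] B) : Prop :=
  ∃ g : B →ₗ[Λ] A, g.comp f = LinearMap.id

/-- A linear map is a split epimorphism. -/
def IsSplitEpiHom {A B : Type v} [AddCommGroup A] [Module Λ A] [AddCommGroup B] [Module Λ B]
    (f : A →ₗ[Λ] B) : Prop :=
  ∃ g : B →ₗ[Λ] A, f.comp g = LinearMap.id

/-- A morphism `f` in the category of finite length `Λ`-modules is irreducible if it is
neither a split monomorphism nor a split epimorphism and, whenever `f = g ∘ h` with the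
intermediate module of finite length, either `h` is a split monomorphism or `g` is a
split epimorphism. -/
def IsIrreducibleHom {A B : Type v} [AddCommGroup A] [Module Λ A] [AddCommGroup B] [Module Λ B]
    (f : A →ₗ[Λ] B) : Prop :=
  ¬ IsSplitMonoHom Λ f ∧ ¬ IsSplitEpiHom Λ f ∧
    ∀ (Z : Type v) [AddCommGroup Z] [Module Λ Z], IsFiniteLength Λ Z →
      ∀ (h : A →ₗ[Λ] Z) (g : Z →ₗ[Λ] B), f = g.comp h →
        IsSplitMonoHom Λ h ∨ IsSplitEpiHom Λ g

/-- An indecomposable submodule `U` of the ambient module is piling provided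
`μ(V) ≤ μ(U)` for every indecomposable submodule `V` with `|V| ≤ |U|`. -/
def IsPilingSub {Y : Type v} [AddCommGroup Y] [Module Λ Y] (U : Submodule Λ Y) : Prop :=
  IndecSub Λ U ∧ ∀ V : Submodule Λ Y, IndecSub Λ V →
    Order.height V ≤ Order.height U → mu Λ V ≤ mu Λ U

/-- A Gabriel-Roiter filtration `c 0 ⊂ c 1 ⊂ ⋯ ⊂ c t = N` of an (indecomposable)
submodule `N`: a chain of indecomposable submodules starting at a simple module such
that each inclusion `c i ⊂ c (i+1)` is a Gabriel-Roiter inclusion,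
i.e. `μ(c (i+1)) = μ(c i) + 2^(-|c (i+1)|)`. -/
def IsGRFiltration {Y : Type v} [AddCommGroup Y] [Module Λ Y] {t : ℕ}
    (c : Fin (t + 1) → Submodule Λ Y) (N : Submodule Λ Y) : Prop :=
  c (Fin.last t) = N ∧
  IsSimpleModule Λ (c 0) ∧
  (∀ i : Fin (t + 1), IndecSub Λ (c i)) ∧
  ∀ i : Fin t, c i.castSucc < c i.succ ∧
    mu Λ (c i.succ) = mu Λ (c i.castSucc) + (2 : ℝ) ^ (-(subLen Λ (c i.succ) : ℤ))

/-- A brick: a nonzero module all of whose nonzero endomorphisms are invertible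
(i.e. the endomorphism ring is a division ring). -/
def IsBrick (M : Type v) [AddCommGroup M] [Module Λ M] : Prop :=
  (∃ x : M, x ≠ 0) ∧ ∀ f : M →ₗ[Λ] M, f ≠ 0 → Function.Bijective f

/-- An `M`-filtration `0 = c 0 ⊂ c 1 ⊂ ⋯ ⊂ c m = Y` of the module `Y`
(so `c j` is the module `M[j]`, with `M[0] = 0`, and the `M`-length of `Y` is `m`):
all consecutive factors `c (i+1) / c i` are isomorphic to `M`. -/
structure IsMFiltration (M : Type v) [AddCommGroup M] [Module Λ M]
    {Y : Type v} [AddCommGroup Y] [Module Λ Y] {m : ℕ}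
    (c : Fin (m + 1) → Submodule Λ Y) : Prop where
  bot : c 0 = ⊥
  top : c (Fin.last m) = ⊤
  lt : ∀ i : Fin m, c i.castSucc < c i.succ
  quot : ∀ i : Fin m,
    Nonempty ((↥(c i.succ) ⧸ comap (c i.succ).subtype (c i.castSucc)) ≃ₗ[Λ] M)

/-- A homogeneous `M`-filtration: an `M`-filtration in which moreover all the
`M[i] = c i` with `i ≥ 1` are indecomposable and all the inclusions
`M[i-1] ⊂ M[i]` for `2 ≤ i ≤ m` are irreducible monomorphisms. -/
structure IsHomogMFiltration (M : Type v) [AddCommGroup M] [Module Λ M]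
    {Y : Type v} [AddCommGroup Y] [Module Λ Y] {m : ℕ}
    (c : Fin (m + 1) → Submodule Λ Y) extends IsMFiltration Λ M c : Prop where
  indec : ∀ i : Fin (m + 1), i ≠ 0 → IndecSub Λ (c i)
  irr : ∀ i : Fin m, (i : ℕ) ≠ 0 →
    IsIrreducibleHom Λ (Submodule.inclusion (toIsMFiltration.lt i).le)

end GRDefs

section GRMeasure

variable {Λ : Type u} [Ring Λ]

section Length

variable {X Y : Type v} [AddCommGroup X] [Module Λ X] [AddCommGroup Y] [Module Λ Y]

lemma subLen_bot : subLen Λ (⊥ : Submodule Λ X) = 0 := by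
  simp [subLen]

lemma Submodule.height_map_of_injective {f : X →ₗ[Λ] Y} (hf : Function.Injective f)
    (N : Submodule Λ X) : Order.height (N.map f) = Order.height N := by
  rw [← Module.length_submodule, ← Module.length_submodule,
    (equivMapOfInjective f hf N).length_eq]

lemma subLen_map_of_injective {f : X →ₗ[Λ] Y} (hf : Function.Injective f)
    (N : Submodule Λ X) : subLen Λ (N.map f) = subLen Λ N := by
  rw [subLen, subLen, height_map_of_injective hf]

lemma cast_subLen [IsArtinian Λ X] [IsNoetherian Λ X] (N : Submodule Λ X) :
    (subLen Λ N : ℕ∞) = Order.height N :=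
  ENat.natCast_toNat N.height_lt_top.ne

lemma subLen_le_subLen_iff [IsArtinian Λ X] [IsNoetherian Λ X] [IsArtinian Λ Y]
    [IsNoetherian Λ Y] {N : Submodule Λ X} {P : Submodule Λ Y} :
    subLen Λ N ≤ subLen Λ P ↔ Order.height N ≤ Order.height P := by
  rw [← cast_subLen, ← cast_subLen, Nat.cast_le]

lemma subLen_strictMono [IsArtinian Λ X] [IsNoetherian Λ X] :
    StrictMono (subLen Λ : Submodule Λ X → ℕ) := fun N P h ↦ by
  have := Submodule.height_strictMono h
  rwa [← cast_subLen, ← cast_subLen, Nat.cast_lt] at this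

lemma subLen_pos [IsArtinian Λ X] [IsNoetherian Λ X] {N : Submodule Λ X} (h : N ≠ ⊥) :
    0 < subLen Λ N :=
  (subLen_bot (Λ := Λ) (X := X)) ▸ subLen_strictMono (bot_lt_iff_ne_bot.mpr h)

lemma subLen_eq_one [IsArtinian Λ X] [IsNoetherian Λ X] {N : Submodule Λ X}
    (h : IsSimpleModule Λ N) : subLen Λ N = 1 := by
  have := Module.length_eq_one Λ N
  rw [Module.length_submodule, ← cast_subLen] at this
  exact_mod_cast this

end Length

section Measure

variable {X Y : Type v} [AddCommGroup X] [Module Λ X] [AddCommGroup Y] [Module Λ Y]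

lemma indecSub_map_iff {f : X →ₗ[Λ] Y} (hf : Function.Injective f) {N : Submodule Λ X} :
    IndecSub Λ (N.map f) ↔ IndecSub Λ N := by
  have hinj := map_injective_of_injective hf
  have hbot : ∀ P : Submodule Λ X, P.map f = ⊥ ↔ P = ⊥ := fun P ↦ by
    rw [← hinj.eq_iff, Submodule.map_bot]
  constructor
  · rintro ⟨h0, h⟩
    refine ⟨fun h' ↦ h0 ((hbot N).2 h'), fun A B hA hB hAB hAB' ↦ ?_⟩
    rw [← hbot A, ← hbot B]
    refine h _ _ (map_mono hA) (map_mono hB) ?_ ?_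
    · rw [← Submodule.map_sup, hAB]
    · rw [← Submodule.map_inf f hf, hAB', Submodule.map_bot]
  · rintro ⟨h0, h⟩
    refine ⟨fun h' ↦ h0 ((hbot N).1 h'), fun A B hA hB hAB hAB' ↦ ?_⟩
    obtain ⟨A, rfl⟩ : ∃ A' : Submodule Λ X, A'.map f = A :=
      ⟨A.comap f, map_comap_eq_self (hA.trans (LinearMap.map_le_range))⟩
    obtain ⟨B, rfl⟩ : ∃ B' : Submodule Λ X, B'.map f = B :=
      ⟨B.comap f, map_comap_eq_self (hB.trans (LinearMap.map_le_range))⟩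
    rw [hbot, hbot]
    rw [map_le_map_iff_of_injective hf] at hA hB
    refine h _ _ hA hB (hinj ?_) (hinj ?_)
    · rw [Submodule.map_sup, hAB]
    · rw [Submodule.map_inf f hf, hAB', Submodule.map_bot]

lemma muAux_map {f : X →ₗ[Λ] Y} (hf : Function.Injective f) (n : ℕ) (N : Submodule Λ X) :
    muAux Λ n (N.map f) = muAux Λ n N := by
  induction n generalizing N with
  | zero => rfl
  | succ n ih =>
    have himg : muAux Λ n '' {N' | N' < N.map f} = muAux Λ n '' {N' | N' < N} := by
      ext r
      constructor
      · rintro ⟨P, hP, rfl⟩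
        have hP' : (P.comap f).map f = P :=
          map_comap_eq_self (hP.le.trans (LinearMap.map_le_range))
        refine ⟨P.comap f, ?_, by rw [← ih, hP']⟩
        exact (map_lt_map_iff_of_injective hf).1 (hP'.trans_lt hP)
      · rintro ⟨P, hP, rfl⟩
        exact ⟨P.map f, map_strictMono_of_injective hf hP, ih P⟩
    rw [muAux, muAux, himg, subLen_map_of_injective hf]
    classical
    congr 1
    exact if_congr (indecSub_map_iff hf) rfl rfl

lemma mu_map {f : X →ₗ[Λ] Y} (hf : Function.Injective f) (N : Submodule Λ X) :
    mu Λ (N.map f) = mu Λ N := by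
  rw [mu, mu, subLen_map_of_injective hf, muAux_map hf]

lemma muMod_coe (N : Submodule Λ X) : muMod Λ N = mu Λ N := by
  rw [muMod, ← mu_map N.subtype_injective, Submodule.map_subtype_top]

lemma indecMod_coe {N : Submodule Λ X} : IndecMod Λ N ↔ IndecSub Λ N := by
  rw [IndecMod, ← indecSub_map_iff N.subtype_injective, Submodule.map_subtype_top]

lemma muMod_range {f : X →ₗ[Λ] Y} (hf : Function.Injective f) :
    mu Λ (LinearMap.range f) = muMod Λ X := by
  rw [muMod, ← mu_map hf, Submodule.map_top]

lemma mu_bot : mu Λ (⊥ : Submodule Λ X) = 0 := by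
  rw [mu, subLen_bot, muAux]

lemma two_zpow_neg_natCast (n : ℕ) : (2 : ℝ) ^ (-(n : ℤ)) = 1 / 2 ^ n := by
  rw [zpow_neg, zpow_natCast, one_div]

section FiniteLength

variable [IsArtinian Λ X] [IsNoetherian Λ X] [IsArtinian Λ Y] [IsNoetherian Λ Y]

lemma muAux_eq_muAux {n m : ℕ} {N : Submodule Λ X} (hn : subLen Λ N ≤ n)
    (hm : subLen Λ N ≤ m) : muAux Λ n N = muAux Λ m N := by
  have hbot : ∀ l, muAux Λ l (⊥ : Submodule Λ X) = 0 := by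
    rintro (_ | l)
    · rfl
    · simp [muAux, IndecSub]
  induction n generalizing m N with
  | zero =>
    obtain rfl : N = ⊥ := by
      by_contra h
      have := subLen_pos h
      omega
    rw [hbot, hbot]
  | succ n ih =>
    cases m with
    | zero =>
      obtain rfl : N = ⊥ := by
        by_contra h
        have := subLen_pos h
        omega
      rw [hbot, hbot]
    | succ m =>
      have himg : muAux Λ n '' {N' | N' < N} = muAux Λ m '' {N' | N' < N} := by
        refine Set.image_congr fun P hP ↦ ?_
        have := subLen_strictMono hP
        exact ih (by omega) (by omega)
      rw [muAux, muAux, himg]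

open Classical in
lemma mu_eq (N : Submodule Λ X) :
    mu Λ N = (if IndecSub Λ N then (2 : ℝ) ^ (-(subLen Λ N : ℤ)) else 0)
      + sSup (mu Λ '' Set.Iio N) := by
  rw [mu, muAux_eq_muAux le_rfl (Nat.le_succ _), muAux]
  congr 2
  refine Set.image_congr fun P hP ↦ ?_
  exact muAux_eq_muAux (subLen_strictMono hP).le le_rfl

lemma exists_mu_eq_div (N : Submodule Λ X) :
    ∃ a : ℕ, mu Λ N = a / 2 ^ subLen Λ N ∧ a < 2 ^ subLen Λ N := by
  classical
  induction N using WellFoundedLT.induction with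
  | ind N ih =>
  by_cases h0 : N = ⊥
  · subst h0
    exact ⟨0, by simp [mu_bot, subLen_bot]⟩
  obtain ⟨l, hl⟩ : ∃ l, subLen Λ N = l + 1 := Nat.exists_eq_succ_of_ne_zero (subLen_pos h0).ne'
  have hsub : mu Λ '' Set.Iio N ⊆ (fun a : ℕ ↦ (a : ℝ) / 2 ^ l) '' Set.Iio (2 ^ l) := by
    rintro _ ⟨P, hP, rfl⟩
    obtain ⟨a, ha, ha'⟩ := ih P hP
    have hPl : subLen Λ P ≤ l := by
      have := subLen_strictMono (Set.mem_Iio.1 hP)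
      omega
    obtain ⟨j, rfl⟩ := Nat.exists_eq_add_of_le hPl
    refine ⟨a * 2 ^ j, ?_, ?_⟩
    · rw [Set.mem_Iio, pow_add]
      gcongr
    · rw [ha]
      push_cast
      rw [pow_add]
      field_simp
  have hfin : (mu Λ '' Set.Iio N).Finite := ((Set.finite_Iio _).image _).subset hsub
  have hne : (mu Λ '' Set.Iio N).Nonempty := ⟨_, ⊥, bot_lt_iff_ne_bot.2 h0, rfl⟩
  obtain ⟨a, ha, hae⟩ := hsub (hne.csSup_mem hfin)
  rw [mu_eq, ← hae, hl, two_zpow_neg_natCast]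
  simp only [Set.mem_Iio] at ha
  split_ifs
  · refine ⟨2 * a + 1, ?_, by rw [pow_succ]; omega⟩
    push_cast
    field_simp
    ring
  · refine ⟨2 * a, ?_, by rw [pow_succ]; omega⟩
    push_cast
    field_simp
    ring

lemma finite_mu_image_Iio (N : Submodule Λ X) : (mu Λ '' Set.Iio N).Finite := by
  refine ((Set.finite_Iio (2 ^ subLen Λ N)).image
    fun a : ℕ ↦ (a : ℝ) / 2 ^ subLen Λ N).subset ?_
  rintro _ ⟨P, hP, rfl⟩
  obtain ⟨a, ha, ha'⟩ := exists_mu_eq_div P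
  obtain ⟨j, hj⟩ := Nat.exists_eq_add_of_le (subLen_strictMono (Set.mem_Iio.1 hP)).le
  refine ⟨a * 2 ^ j, ?_, ?_⟩
  · rw [Set.mem_Iio, hj, pow_add]
    gcongr
  · rw [ha, hj, pow_add]
    push_cast
    field_simp

lemma exists_lt_mu_eq_sSup {N : Submodule Λ X} (h : N ≠ ⊥) :
    ∃ P < N, mu Λ P = sSup (mu Λ '' Set.Iio N) := by
  have hne : (mu Λ '' Set.Iio N).Nonempty := ⟨_, ⊥, bot_lt_iff_ne_bot.2 h, rfl⟩
  exact hne.csSup_mem (finite_mu_image_Iio N)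

lemma mu_le_sSup {N P : Submodule Λ X} (h : P < N) : mu Λ P ≤ sSup (mu Λ '' Set.Iio N) :=
  le_csSup (finite_mu_image_Iio N).bddAbove ⟨P, h, rfl⟩

lemma mu_of_indecSub {N : Submodule Λ X} (h : IndecSub Λ N) :
    mu Λ N = sSup (mu Λ '' Set.Iio N) + 1 / 2 ^ subLen Λ N := by
  rw [mu_eq, if_pos h, two_zpow_neg_natCast, add_comm]

lemma mu_of_not_indecSub {N : Submodule Λ X} (h : ¬ IndecSub Λ N) :
    mu Λ N = sSup (mu Λ '' Set.Iio N) := by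
  rw [mu_eq, if_neg h, zero_add]

lemma mu_lt_of_lt {N P : Submodule Λ X} (h : P < N) (hN : IndecSub Λ N) : mu Λ P < mu Λ N := by
  have := mu_le_sSup h
  rw [mu_of_indecSub hN]
  have : (0 : ℝ) < 1 / 2 ^ subLen Λ N := by positivity
  linarith

lemma mu_mono : Monotone (mu Λ : Submodule Λ X → ℝ) := by
  intro P N h
  rcases h.eq_or_lt with rfl | h
  · rfl
  by_cases hN : IndecSub Λ N
  · exact (mu_lt_of_lt h hN).le
  · rw [mu_of_not_indecSub hN]
    exact mu_le_sSup h

lemma mu_pos {N : Submodule Λ X} (h : N ≠ ⊥) : 0 < mu Λ N := by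
  induction N using WellFoundedLT.induction with
  | ind N ih =>
  by_cases hN : IndecSub Λ N
  · exact mu_bot (Λ := Λ) (X := X) ▸ mu_lt_of_lt (bot_lt_iff_ne_bot.2 h) hN
  simp only [IndecSub, not_and, not_forall] at hN
  obtain ⟨A, B, hA, hB, hAB, hAB', hn⟩ := hN h
  push Not at hn
  have hAN : A < N := by
    refine lt_of_le_of_ne hA ?_
    rintro rfl
    exact hn.2 (by rw [← hAB', inf_eq_right.2 hB])
  exact (ih A hAN hn.1).trans_le (mu_mono hA)

lemma exists_indecSub_mu_eq {N : Submodule Λ X} (h : N ≠ ⊥) :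
    ∃ P ≤ N, IndecSub Λ P ∧ mu Λ P = mu Λ N := by
  induction N using WellFoundedLT.induction with
  | ind N ih =>
  by_cases hN : IndecSub Λ N
  · exact ⟨N, le_rfl, hN, rfl⟩
  obtain ⟨P, hP, hPN⟩ := exists_lt_mu_eq_sSup h
  rw [← mu_of_not_indecSub hN] at hPN
  have hP0 : P ≠ ⊥ := by
    rintro rfl
    rw [mu_bot] at hPN
    exact (mu_pos h).ne hPN
  obtain ⟨Q, hQP, hQ, hQ'⟩ := ih P hP hP0
  exact ⟨Q, hQP.trans hP.le, hQ, hQ'.trans hPN⟩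

lemma exists_gabrielRoiter_sub {N A : Submodule Λ X} (hN : IndecSub Λ N) (hA : A < N)
    (hA0 : A ≠ ⊥) :
    ∃ P < N, IndecSub Λ P ∧ mu Λ N = mu Λ P + 1 / 2 ^ subLen Λ N := by
  obtain ⟨P, hP, hPN⟩ := exists_lt_mu_eq_sSup hN.1
  have hP0 : P ≠ ⊥ := by
    rintro rfl
    have := mu_le_sSup hA
    rw [← hPN, mu_bot] at this
    exact (mu_pos hA0).not_ge this
  obtain ⟨Q, hQP, hQ, hQ'⟩ := exists_indecSub_mu_eq hP0
  exact ⟨Q, hQP.trans_lt hP, hQ, by rw [hQ', hPN, mu_of_indecSub hN]⟩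

lemma mu_add_le_of_lt {A : Submodule Λ X} {B : Submodule Λ Y} {n : ℕ} (h : mu Λ A < mu Λ B)
    (hA : subLen Λ A ≤ n) (hB : subLen Λ B ≤ n) : mu Λ A + 1 / 2 ^ n ≤ mu Λ B := by
  obtain ⟨a, ha, -⟩ := exists_mu_eq_div A
  obtain ⟨b, hb, -⟩ := exists_mu_eq_div B
  obtain ⟨i, hi⟩ := Nat.exists_eq_add_of_le hA
  obtain ⟨j, hj⟩ := Nat.exists_eq_add_of_le hB
  have ha' : mu Λ A = ((a * 2 ^ i : ℕ) : ℝ) / 2 ^ n := by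
    rw [ha, hi, pow_add]
    push_cast
    field_simp
  have hb' : mu Λ B = ((b * 2 ^ j : ℕ) : ℝ) / 2 ^ n := by
    rw [hb, hj, pow_add]
    push_cast
    field_simp
  rw [ha', hb'] at h ⊢
  rw [div_lt_div_iff_of_pos_right (by positivity), Nat.cast_lt] at h
  rw [← add_div]
  gcongr
  exact_mod_cast h

omit [IsArtinian Λ X] [IsNoetherian Λ X] in
lemma muMod_le_of_injective {f : X →ₗ[Λ] Y} (hf : Function.Injective f) :
    muMod Λ X ≤ muMod Λ Y := by
  rw [← muMod_range hf]
  exact mu_mono le_top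

omit [IsArtinian Λ Y] [IsNoetherian Λ Y] in
lemma muMod_quotient_le_of_ker_eq {f : X →ₗ[Λ] Y} {K : Submodule Λ X}
    (h : LinearMap.ker f = K) : muMod Λ (X ⧸ K) ≤ mu Λ (LinearMap.range f) := by
  subst h
  rw [← muMod_coe]
  exact muMod_le_of_injective (f := f.quotKerEquivRange.toLinearMap)
    f.quotKerEquivRange.injective

omit [IsArtinian Λ Y] [IsNoetherian Λ Y] in
lemma exists_finset_indecMod_quotient (K : Submodule Λ X) :
    ∃ T : Finset (Submodule Λ X), T.inf id = K ∧
      ∀ L ∈ T, IndecMod Λ (X ⧸ L) ∧ muMod Λ (X ⧸ L) ≤ muMod Λ (X ⧸ K) := by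
  classical
  induction K using WellFoundedGT.induction with
  | ind K ih =>
  by_cases htop : K = ⊤
  · exact ⟨∅, by simp [htop], by simp⟩
  by_cases hK : IndecMod Λ (X ⧸ K)
  · exact ⟨{K}, by simp, by simp [hK]⟩
  have h0 : (⊤ : Submodule Λ (X ⧸ K)) ≠ ⊥ := by
    have := Submodule.Quotient.nontrivial_iff.2 htop
    exact top_ne_bot
  simp only [IndecMod, IndecSub, not_and, not_forall] at hK
  obtain ⟨A, B, -, -, hAB, hAB', hn⟩ := hK h0
  push Not at hn
  have key : ∀ A B : Submodule Λ (X ⧸ K), A ≠ ⊥ → A ⊔ B = ⊤ → A ⊓ B = ⊥ →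
      K < A.comap K.mkQ ∧
        muMod Λ (X ⧸ A.comap K.mkQ) ≤ muMod Λ (X ⧸ K) := by
    intro A B hA hAB hAB'
    constructor
    · refine lt_of_le_of_ne (le_comap_mkQ K A) fun h ↦ hA ?_
      rw [← map_comap_eq_of_surjective K.mkQ_surjective A, ← h, mkQ_map_self]
    · have hc : IsCompl B A := ⟨by rw [disjoint_iff, inf_comm, hAB'],
        by rw [codisjoint_iff, sup_comm, hAB]⟩
      refine (muMod_quotient_le_of_ker_eq (f := (B.projectionOnto A hc) ∘ₗ K.mkQ) ?_).trans
        ((mu_mono le_top).trans ?_)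
      · rw [LinearMap.ker_comp]
        simp
      · exact muMod_le_of_injective B.subtype_injective
  obtain ⟨hA, hA'⟩ := key A B hn.1 hAB hAB'
  obtain ⟨hB, hB'⟩ := key B A hn.2 (by rw [sup_comm, hAB]) (by rw [inf_comm, hAB'])
  obtain ⟨S, hS, hS'⟩ := ih _ hA
  obtain ⟨T, hT, hT'⟩ := ih _ hB
  refine ⟨S ∪ T, ?_, fun L hL ↦ ?_⟩
  · rw [Finset.inf_union, hS, hT, ← comap_inf, hAB', comap_bot, ker_mkQ]
  · rcases Finset.mem_union.1 hL with hL | hL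
    · exact ⟨(hS' L hL).1, (hS' L hL).2.trans hA'⟩
    · exact ⟨(hT' L hL).1, (hT' L hL).2.trans hB'⟩

end FiniteLength

/-- Gabriel's main property: if an indecomposable module embeds into a finite direct sum,
then it embeds into one of the summands or has smaller measure than one of them. -/
theorem exists_eq_bot_or_muMod_lt [IsArtinian Λ X] [IsNoetherian Λ X] (hX : IndecMod Λ X)
    (S : Finset (Submodule Λ X)) (hS : S.inf id = ⊥) :
    ∃ K ∈ S, K = ⊥ ∨ muMod Λ X < muMod Λ (X ⧸ K) := by
  classical
  induction hn : subLen Λ (⊤ : Submodule Λ X) using Nat.strong_induction_on generalizing X with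
  | h n ih =>
  subst hn
  have core : ∀ T : Finset (Submodule Λ X), T.inf id = ⊥ → (∀ K ∈ T, IndecMod Λ (X ⧸ K)) →
      ∃ K ∈ T, K = ⊥ ∨ muMod Λ X < muMod Λ (X ⧸ K) := by
    intro T hT hind
    by_contra! hcon
    have hlen : ∀ K ∈ T, subLen Λ (⊤ : Submodule Λ (X ⧸ K)) < subLen Λ (⊤ : Submodule Λ X) := by
      intro K hK
      have := Submodule.length_quotient_lt K (hcon K hK).1
      rw [Module.length_eq_height, Module.length_eq_height, ← cast_subLen, ← cast_subLen] at this
      exact_mod_cast this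
    obtain ⟨K₀, hK₀⟩ : T.Nonempty := by
      by_contra! h
      subst h
      exact hX.1 (by simpa using hT)
    have hK₀top : K₀ < ⊤ := by
      have := (hind K₀ hK₀).1
      rw [lt_top_iff_ne_top]
      rintro rfl
      exact this (Subsingleton.elim _ _)
    obtain ⟨P, hP, hPind, hPmu⟩ := exists_gabrielRoiter_sub hX hK₀top (hcon K₀ hK₀).1
    have hlenP : subLen Λ (⊤ : Submodule Λ P) = subLen Λ P := by
      rw [← subLen_map_of_injective P.subtype_injective, Submodule.map_subtype_top]
    obtain ⟨L, hL, hLP⟩ := ih _ (by rw [hlenP]; exact subLen_strictMono hP)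
      (indecMod_coe.2 hPind) (T.image fun K ↦ K.comap P.subtype) (by
        rw [Finset.inf_image, eq_bot_iff]
        intro x hx
        have : (x : X) ∈ T.inf id := by
          simpa [Submodule.mem_finsetInf] using hx
        rw [hT] at this
        simpa using this) rfl
    obtain ⟨K, hK, rfl⟩ := Finset.mem_image.1 hL
    have hker : LinearMap.ker (K.mkQ ∘ₗ P.subtype) = K.comap P.subtype := by
      rw [LinearMap.ker_comp, ker_mkQ]
    have hnlt : ¬ mu Λ P < muMod Λ (X ⧸ K) := fun h ↦ by
      have h1 := mu_add_le_of_lt (n := subLen Λ (⊤ : Submodule Λ X) - 1) h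
        (Nat.le_sub_one_of_lt (subLen_strictMono hP)) (Nat.le_sub_one_of_lt (hlen K hK))
      have h2 : (1 : ℝ) / 2 ^ subLen Λ (⊤ : Submodule Λ X) <
          1 / 2 ^ (subLen Λ (⊤ : Submodule Λ X) - 1) := by
        gcongr
        · norm_num
        · have := hlen K hK
          omega
      have h3 := (hcon K hK).2
      have h4 : mu Λ (⊤ : Submodule Λ X) = muMod Λ X := rfl
      have h5 : mu Λ (⊤ : Submodule Λ (X ⧸ K)) = muMod Λ (X ⧸ K) := rfl
      linarith
    rcases hLP with hbot | hlt
    · have hinj : Function.Injective (K.mkQ ∘ₗ P.subtype) := by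
        rw [← LinearMap.ker_eq_bot, hker, hbot]
      have hrange : LinearMap.range (K.mkQ ∘ₗ P.subtype) = ⊤ := by
        by_contra h
        refine hnlt ?_
        rw [← muMod_coe, ← muMod_range hinj]
        exact mu_lt_of_lt (lt_top_iff_ne_top.2 h) (hind K hK)
      have hsup : P ⊔ K = ⊤ := by
        have := congrArg (comap K.mkQ) hrange
        rw [LinearMap.range_comp, range_subtype, comap_map_mkQ, comap_top] at this
        rwa [sup_comm]
      have hinf : P ⊓ K = ⊥ := by
        rw [← map_comap_subtype, hbot, Submodule.map_bot]
      rcases hX.2 P K le_top le_top hsup hinf with h | h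
      · exact hPind.1 h
      · exact (hcon K hK).1 h
    · refine hnlt ?_
      rw [← muMod_coe]
      exact hlt.trans_le ((muMod_quotient_le_of_ker_eq hker).trans (mu_mono le_top))
  choose F hF hF' using fun K : Submodule Λ X ↦ exists_finset_indecMod_quotient K
  obtain ⟨L, hL, hLX⟩ := core (S.biUnion F) (by
    rw [Finset.inf_biUnion, ← hS]
    exact Finset.inf_congr rfl fun K _ ↦ hF K) (by
    intro L hL
    obtain ⟨K, hK, hLK⟩ := Finset.mem_biUnion.1 hL
    exact (hF' K L hLK).1)
  obtain ⟨K, hK, hLK⟩ := Finset.mem_biUnion.1 hL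
  refine ⟨K, hK, hLX.imp (fun h ↦ ?_) fun h ↦ h.trans_le (hF' K L hLK).2⟩
  rw [eq_bot_iff, ← h, ← hF K]
  exact Finset.inf_le (f := id) hLK

end Measure

end GRMeasure

section GRHomogeneous

variable {Λ : Type u} [Ring Λ] {M Y V : Type v} [AddCommGroup M] [Module Λ M]
  [AddCommGroup Y] [Module Λ Y] [AddCommGroup V] [Module Λ V]

/-- A module mapping to a module with a homogeneous `M`-filtration either maps onto `M`, or
the kernel of the given map is a finite intersection of kernels of non-surjective maps to `M`. -/
lemma IsHomogMFiltration.exists_surjective_or_exists_finset [IsArtinian Λ Y] [IsNoetherian Λ Y]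
    {m : ℕ} {c : Fin (m + 1) → Submodule Λ Y} (hc : IsHomogMFiltration Λ M c)
    (j : Fin (m + 1)) (f : V →ₗ[Λ] Y) (hf : ∀ v, f v ∈ c j) :
    (∃ g : V →ₗ[Λ] M, Function.Surjective g) ∨
      ∃ S : Finset (Submodule Λ V), S.inf id = LinearMap.ker f ∧
        ∀ K ∈ S, ∃ g : V →ₗ[Λ] M, ¬ Function.Surjective g ∧ LinearMap.ker g = K := by
  classical
  induction j using Fin.induction generalizing f with
  | zero =>
    refine Or.inr ⟨∅, ?_, by simp⟩
    rw [Finset.inf_empty, eq_comm, LinearMap.ker_eq_top]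
    ext v
    simpa [hc.bot] using hf v
  | succ i ih =>
    obtain ⟨e⟩ := hc.quot i
    set q : c i.succ →ₗ[Λ] M := e.toLinearMap ∘ₗ (comap (c i.succ).subtype (c i.castSucc)).mkQ
      with hq
    have hqs : Function.Surjective q := e.surjective.comp (mkQ_surjective _)
    have hqk : ∀ z, q z = 0 ↔ (z : Y) ∈ c i.castSucc := by
      intro z
      simp [hq]
    set g : V →ₗ[Λ] M := q ∘ₗ f.codRestrict (c i.succ) hf with hg
    have hgk : ∀ v, g v = 0 ↔ f v ∈ c i.castSucc := fun v ↦ hqk _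
    by_cases hgs : Function.Surjective g
    · exact Or.inl ⟨g, hgs⟩
    by_cases hi : (i : ℕ) = 0
    · refine Or.inr ⟨{LinearMap.ker g}, ?_, by simpa using ⟨g, hgs, rfl⟩⟩
      have hi' : i.castSucc = 0 := Fin.ext hi
      ext v
      simp [hgk, hi', hc.bot]
    have hle : LinearMap.range f ⊔ c i.castSucc ≤ c i.succ := by
      refine sup_le ?_ (hc.lt i).le
      rintro _ ⟨v, rfl⟩
      exact hf v
    have hfl : IsFiniteLength Λ ↥(LinearMap.range f ⊔ c i.castSucc) :=
      isFiniteLength_iff_isNoetherian_isArtinian.2 ⟨inferInstance, inferInstance⟩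
    rcases (hc.irr i hi).2.2 _ hfl (Submodule.inclusion le_sup_right)
      (Submodule.inclusion hle) rfl with ⟨r, hr⟩ | ⟨s, hs⟩
    · have hr' : ∀ (y : Y) (hy : y ∈ c i.castSucc), r ⟨y, mem_sup_right hy⟩ = ⟨y, hy⟩ :=
        fun y hy ↦ LinearMap.congr_fun hr ⟨y, hy⟩
      set f' : V →ₗ[Λ] Y := (c i.castSucc).subtype ∘ₗ r ∘ₗ
        f.codRestrict _ (fun v ↦ mem_sup_left (LinearMap.mem_range_self f v)) with hf'
      refine (ih f' fun v ↦ (r _).2).imp id ?_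
      rintro ⟨S, hS, hS'⟩
      refine ⟨insert (LinearMap.ker g) S, ?_, ?_⟩
      · rw [Finset.inf_insert, hS]
        ext v
        rw [id, mem_inf, LinearMap.mem_ker, LinearMap.mem_ker, LinearMap.mem_ker, hgk]
        constructor
        · rintro ⟨h1, h2⟩
          have := congrArg Subtype.val (hr' (f v) h1)
          exact this.symm.trans h2
        · intro h
          have h1 : f v ∈ c i.castSucc := by simp [h]
          exact ⟨h1, (congrArg Subtype.val (hr' (f v) h1)).trans h⟩
      · simpa using ⟨⟨g, hgs, rfl⟩, hS'⟩
    · refine absurd (fun y ↦ ?_) hgs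
      obtain ⟨z, rfl⟩ := hqs y
      have hz : (z : Y) ∈ LinearMap.range f ⊔ c i.castSucc := by
        have := congrArg Subtype.val (LinearMap.congr_fun hs z)
        rw [LinearMap.id_apply] at this
        rw [← this]
        exact (s z).2
      obtain ⟨_, ⟨v, rfl⟩, w, hw, hvw⟩ := mem_sup.1 hz
      refine ⟨v, ?_⟩
      rw [← sub_eq_zero, hg, LinearMap.comp_apply, ← map_sub, hqk]
      have : f v - z = -w := by rw [← hvw]; abel
      simpa [this] using hw

lemma IsHomogMFiltration.mu_le_of_not_surjective [IsArtinian Λ Y] [IsNoetherian Λ Y]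
    [IsArtinian Λ M] [IsNoetherian Λ M]
    {m : ℕ} {c : Fin (m + 1) → Submodule Λ Y} (hc : IsHomogMFiltration Λ M c)
    {N : Submodule Λ Y} (hN : IndecSub Λ N)
    (h : ¬ ∃ g : N →ₗ[Λ] M, Function.Surjective g) :
    mu Λ N ≤ sSup (mu Λ '' Set.Iio (⊤ : Submodule Λ M)) := by
  obtain ⟨S, hS, hS'⟩ := (hc.exists_surjective_or_exists_finset (Fin.last m) N.subtype
    (fun v ↦ hc.top ▸ mem_top)).resolve_left h
  rw [ker_subtype] at hS
  obtain ⟨K, hK, hKN⟩ := exists_eq_bot_or_muMod_lt (indecMod_coe.2 hN) S hS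
  obtain ⟨g, hg, hgK⟩ := hS' K hK
  have hlt : LinearMap.range g < ⊤ := by
    rwa [lt_top_iff_ne_top, ne_eq, LinearMap.range_eq_top]
  rw [← muMod_coe]
  refine le_trans ?_ (mu_le_sSup hlt)
  rcases hKN with rfl | hKN
  · exact (muMod_range (LinearMap.ker_eq_bot.1 hgK)).ge
  · exact hKN.le.trans (muMod_quotient_le_of_ker_eq hgK)

lemma IsGRFiltration.monotone {t : ℕ} {d : Fin (t + 1) → Submodule Λ Y} {U : Submodule Λ Y}
    (hd : IsGRFiltration Λ d U) : Monotone d :=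
  Fin.monotone_iff_le_succ.2 fun i ↦ (hd.2.2.2 i).1.le

lemma IsGRFiltration.mu_add_le [IsArtinian Λ Y] [IsNoetherian Λ Y] {t : ℕ}
    {d : Fin (t + 1) → Submodule Λ Y} {U : Submodule Λ Y}
    (hd : IsGRFiltration Λ d U) {i j : Fin (t + 1)} (hij : i ≤ j) :
    mu Λ (d j) + 1 / 2 ^ subLen Λ (d j) ≤ mu Λ (d i) + 1 / 2 ^ subLen Λ (d i) := by
  induction j using Fin.induction with
  | zero => rw [Fin.le_zero_iff.1 hij]
  | succ j ih =>
    rcases hij.eq_or_lt with rfl | hij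
    · rfl
    refine le_trans ?_ (ih (Fin.le_castSucc_iff.2 hij))
    obtain ⟨hlt, hmu⟩ := hd.2.2.2 j
    obtain ⟨a, ha⟩ := Nat.exists_eq_add_of_lt (subLen_strictMono hlt)
    rw [hmu, two_zpow_neg_natCast, add_assoc]
    gcongr
    rw [ha, pow_succ, pow_add, ← add_div, div_le_div_iff₀ (by positivity) (by positivity)]
    have : (1 : ℝ) ≤ 2 ^ a := one_le_pow₀ (by norm_num)
    have : (0 : ℝ) < 2 ^ subLen Λ (d j.castSucc) := by positivity
    nlinarith

/-- The members of a Gabriel-Roiter filtration of a piling submodule are piling. -/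
lemma IsGRFiltration.isPilingSub [IsArtinian Λ Y] [IsNoetherian Λ Y] {t : ℕ}
    {d : Fin (t + 1) → Submodule Λ Y} {U : Submodule Λ Y}
    (hd : IsGRFiltration Λ d U) (hU : IsPilingSub Λ U) (i : Fin (t + 1)) :
    IsPilingSub Λ (d i) := by
  refine ⟨hd.2.2.1 i, fun W hW hle ↦ ?_⟩
  by_contra! hlt
  have h1 := mu_add_le_of_lt hlt le_rfl (subLen_le_subLen_iff.2 hle)
  have h2 := hd.mu_add_le (Fin.le_last i)
  have hdU : d i ≤ U := hd.1 ▸ hd.monotone (Fin.le_last i)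
  have h3 := hU.2 W hW (hle.trans (Order.height_mono hdU))
  rw [hd.1] at h2
  have : (0 : ℝ) < 1 / 2 ^ subLen Λ U := by positivity
  linarith

lemma LinearMap.injective_of_surjective_of_subLen_le [IsArtinian Λ V] [IsNoetherian Λ V]
    [IsArtinian Λ M] [IsNoetherian Λ M] {g : V →ₗ[Λ] M} (hg : Function.Surjective g)
    (h : subLen Λ (⊤ : Submodule Λ V) ≤ subLen Λ (⊤ : Submodule Λ M)) :
    Function.Injective g := by
  rw [← LinearMap.ker_eq_bot]
  by_contra hk
  have h1 := Submodule.length_quotient_lt _ hk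
  rw [(g.quotKerEquivOfSurjective hg).length_eq, Module.length_eq_height,
    Module.length_eq_height] at h1
  exact h1.not_ge (subLen_le_subLen_iff.1 h)

end GRHomogeneous

/-- Let `M` be indecomposable and `Y` a module with a homogeneous
`M`-filtration. If `U` is a piling submodule of `Y` with `|U| ≥ |M|`, then every
Gabriel-Roiter filtration of `U` contains a module isomorphic to `M`. -/
theorem gabriel_roiter_stmt13
    (k : Type u) [CommRing k] [IsArtinianRing k]
    (Λ : Type u) [Ring Λ] [Algebra k Λ] [Module.Finite k Λ]
    (M : Type v) [AddCommGroup M] [Module Λ M] (hMfl : IsFiniteLength Λ M)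
    (hMind : IndecMod Λ M)
    (Y : Type v) [AddCommGroup Y] [Module Λ Y] (hYfl : IsFiniteLength Λ Y)
    (m : ℕ) (c : Fin (m + 1) → Submodule Λ Y) (hc : IsHomogMFiltration Λ M c)
    (U : Submodule Λ Y) (hU : IsPilingSub Λ U)
    (hlen : modLen Λ M ≤ Order.height U) :
    ∀ (t : ℕ) (d : Fin (t + 1) → Submodule Λ Y), IsGRFiltration Λ d U →
      ∃ i : Fin (t + 1), Nonempty (↥(d i) ≃ₗ[Λ] M) := by
  intro t d hd
  obtain ⟨_, _⟩ := isFiniteLength_iff_isNoetherian_isArtinian.1 hMfl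
  obtain ⟨_, _⟩ := isFiniteLength_iff_isNoetherian_isArtinian.1 hYfl
  obtain ⟨m, rfl⟩ : ∃ n, m = n + 1 := by
    refine Nat.exists_eq_succ_of_ne_zero ?_
    rintro rfl
    have htb : (⊥ : Submodule Λ Y) = ⊤ := hc.bot.symm.trans hc.top
    exact hU.1.1 (eq_bot_iff.2 (htb ▸ le_top))
  obtain ⟨e⟩ := hc.quot 0
  have hker : comap (c (Fin.succ 0)).subtype (c (Fin.castSucc 0)) = ⊥ := by
    rw [Fin.castSucc_zero, hc.bot, comap_bot, ker_subtype]
  obtain ⟨e'⟩ : Nonempty (M ≃ₗ[Λ] c (Fin.succ 0)) :=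
    ⟨e.symm.trans (quotEquivOfEqBot _ hker)⟩
  have hc1 := hc.indec (Fin.succ 0) (Fin.succ_ne_zero 0)
  have hinj : Function.Injective ((c (Fin.succ 0)).subtype ∘ₗ e'.toLinearMap) :=
    (c (Fin.succ 0)).subtype_injective.comp e'.injective
  have hrange : (⊤ : Submodule Λ M).map ((c (Fin.succ 0)).subtype ∘ₗ e'.toLinearMap)
      = c (Fin.succ 0) := by
    rw [Submodule.map_top, LinearMap.range_comp, LinearEquiv.range, Submodule.map_subtype_top]
  have hmuM : mu Λ (c (Fin.succ 0)) = mu Λ (⊤ : Submodule Λ M) := by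
    rw [← hrange, mu_map hinj]
  have hlenM : subLen Λ (c (Fin.succ 0)) = subLen Λ (⊤ : Submodule Λ M) := by
    rw [← hrange, subLen_map_of_injective hinj]
  have hex : ∃ n : ℕ, ∃ h : n < t + 1, subLen Λ (⊤ : Submodule Λ M) ≤ subLen Λ (d ⟨n, h⟩) := by
    refine ⟨t, t.lt_succ_self, ?_⟩
    rw [subLen_le_subLen_iff]
    exact hlen.trans_eq (congrArg Order.height hd.1.symm)
  classical
  obtain ⟨hn, hnle⟩ := Nat.find_spec hex
  have hmin := fun n ↦ Nat.find_min hex (m := n)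
  generalize Nat.find hex = n at hn hnle hmin
  have hmu : mu Λ (⊤ : Submodule Λ M) ≤ mu Λ (d ⟨n, hn⟩) := by
    rw [← hmuM]
    refine (hd.isPilingSub hU ⟨n, hn⟩).2 _ hc1 ?_
    rwa [← subLen_le_subLen_iff, hlenM]
  have hM := mu_of_indecSub hMind
  have hnot : ∀ i, mu Λ (⊤ : Submodule Λ M) ≤ mu Λ (d i) →
      ∃ g : d i →ₗ[Λ] M, Function.Surjective g := by
    intro i hi
    by_contra h
    have h1 := hc.mu_le_of_not_surjective (hd.2.2.1 i) h
    have : (0 : ℝ) < 1 / 2 ^ subLen Λ (⊤ : Submodule Λ M) := by positivity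
    linarith
  have hlen_top : ∀ N : Submodule Λ Y, subLen Λ (⊤ : Submodule Λ N) = subLen Λ N := fun N ↦ by
    rw [← subLen_map_of_injective N.subtype_injective, Submodule.map_subtype_top]
  have hle : subLen Λ (d ⟨n, hn⟩) ≤ subLen Λ (⊤ : Submodule Λ M) := by
    cases n with
    | zero =>
      have : subLen Λ (d ⟨0, hn⟩) = 1 := subLen_eq_one hd.2.1
      rw [this]
      exact subLen_pos hMind.1
    | succ n =>
      have hn' : n < t := Nat.lt_of_succ_lt_succ hn
      have hlt : subLen Λ (d (Fin.castSucc ⟨n, hn'⟩)) < subLen Λ (⊤ : Submodule Λ M) := by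
        by_contra! h
        exact hmin n n.lt_succ_self ⟨hn'.trans t.lt_succ_self, h⟩
      have h1 := hc.mu_le_of_not_surjective (hd.2.2.1 (Fin.castSucc ⟨n, hn'⟩)) (by
        rintro ⟨g, hg⟩
        have := Module.length_le_of_surjective g hg
        rw [Module.length_eq_height, Module.length_eq_height, ← subLen_le_subLen_iff,
          hlen_top] at this
        omega)
      have h2 := (hd.2.2.2 ⟨n, hn'⟩).2
      rw [two_zpow_neg_natCast] at h2
      have hmu' : mu Λ (⊤ : Submodule Λ M) ≤ mu Λ (d (Fin.succ ⟨n, hn'⟩)) := hmu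
      have h3 : (1 : ℝ) / 2 ^ subLen Λ (⊤ : Submodule Λ M) ≤
          1 / 2 ^ subLen Λ (d (Fin.succ ⟨n, hn'⟩)) := by linarith
      rw [one_div_le_one_div (by positivity) (by positivity)] at h3
      exact (pow_le_pow_iff_right₀ (by norm_num)).1 h3
  obtain ⟨g, hg⟩ := hnot _ hmu
  exact ⟨_, ⟨LinearEquiv.ofBijective g
    ⟨LinearMap.injective_of_surjective_of_subLen_le hg (by rwa [hlen_top]), hg⟩⟩⟩
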